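/- arXiv:2507.09387 — 2 statements merged into one kernel-verified Lean document; each statement's English description precedes it below -/
import Mathlib

section
/- There exist real numbers ρ₀, ρ₁, ρ₂ with ρ₀ + ρ₁ + ρ₂ = 1 and each ρ_a > 0 such that for every ε₁ > 0 there is an N₁ with the property: for every factor u of G of length at least N₁ and every letter a ∈ Σ₃, one has ρ_a − ε₁ < |u|_a/|u| < ρ_a + ε₁, where |u|_a denotes the number of occurrences of the letter a in u. (That is, G has uniform letter frequencies.) -/
/-! Common definitions: the alphabet Σ₃, finite and infinite words, factors,
factor complexity, periods and exponents, morphisms, the morphism γ and its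
fixed point G = γ^ω(0). -/

abbrev Sigma3 := Fin 3
abbrev Word := List Sigma3
abbrev InfWord := ℕ → Sigma3

/-- `u` is a factor of the infinite word `w`. -/
def IsFactor (u : Word) (w : InfWord) : Prop :=
  ∃ i : ℕ, u = (List.range u.length).map (fun j => w (i + j))

/-- The set of finite factors of `w`. -/
def Lang (w : InfWord) : Set Word := {u | IsFactor u w}

/-- Factor complexity: the number of distinct length-`n` factors of `w`. -/
noncomputable def complexity (w : InfWord) (n : ℕ) : ℕ :=
  Set.ncard {u : Word | IsFactor u w ∧ u.length = n}

/-- `v` has period `p` (with `p ≥ 1`). -/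
def HasPeriod (v : Word) (p : ℕ) : Prop :=
  1 ≤ p ∧ ∀ i, i + p < v.length → v.getD i 0 = v.getD (i + p) 0

/-- The least period of `v`. -/
noncomputable def minPeriod (v : Word) : ℕ := sInf {p | HasPeriod v p}

/-- The exponent `|v| / p` of a nonempty finite word `v`, where `p` is its least period. -/
noncomputable def expo (v : Word) : ℝ := (v.length : ℝ) / (minPeriod v : ℝ)

/-- `w` contains no factor of exponent `5/2` or greater. -/
def NoFiveHalves (w : InfWord) : Prop :=
  ∀ u : Word, u ≠ [] → IsFactor u w → expo u < 5 / 2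

/-- Apply a morphism (given by the images of the three letters) to a finite word. -/
def applyM (f : Sigma3 → Word) (u : Word) : Word := (u.map f).flatten

/-- The image under `f` of the length-`k` prefix of the infinite word `u`. -/
def imPrefix (f : Sigma3 → Word) (u : InfWord) (k : ℕ) : Word :=
  applyM f ((List.range k).map u)

/-- The image of an infinite word under a (non-erasing) morphism. -/
def applyMInf (f : Sigma3 → Word) (u : InfWord) : InfWord :=
  fun n => (imPrefix f u (n + 1)).getD n 0

/-- The morphism `γ = [01, 2, 02]`. -/
def gam : Sigma3 → Word := ![[0, 1], [2], [0, 2]]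

/-- The fixed point `G = γ^ω(0)` of `γ`, the unique infinite fixed point beginning with 0. -/
def G : InfWord := fun n => ((applyM gam)^[n + 1] [0]).getD n 0

/-- The final segment of `w` starting at position `k`. -/
def shift (w : InfWord) (k : ℕ) : InfWord := fun i => w (i + k)

/-- The reverse `h^R` of a morphism `h`. -/
def mR (f : Sigma3 → Word) : Sigma3 → Word := fun x => (f x).reverse

lemma applyM_append (f : Sigma3 → Word) (u v : Word) :
    applyM f (u ++ v) = applyM f u ++ applyM f v := by
  simp [applyM]

lemma applyM_cons (f : Sigma3 → Word) (a : Sigma3) (u : Word) :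
    applyM f (a :: u) = f a ++ applyM f u := by
  simp [applyM]

lemma applyM_gam_ne_nil {u : Word} (hu : u ≠ []) : applyM gam u ≠ [] := by
  cases u with
  | nil => exact absurd rfl hu
  | cons a u => fin_cases a <;> simp [applyM_cons, gam]

/-- The iterates of `γ` on `0` form a strictly increasing chain of prefixes. -/
lemma exists_iterate_gam_succ_eq_append (k : ℕ) :
    ∃ t : Word, t ≠ [] ∧ (applyM gam)^[k + 1] [0] = (applyM gam)^[k] [0] ++ t := by
  induction k with
  | zero => exact ⟨[1], by simp, by simp [applyM, gam]⟩
  | succ k ih =>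
    obtain ⟨t, ht, h⟩ := ih
    refine ⟨applyM gam t, applyM_gam_ne_nil ht, ?_⟩
    conv_lhs => rw [Function.iterate_succ_apply', h, applyM_append,
      ← Function.iterate_succ_apply' (applyM gam)]

lemma lt_length_iterate_gam (k : ℕ) : k < ((applyM gam)^[k] [0]).length := by
  induction k with
  | zero => simp
  | succ k ih =>
    obtain ⟨t, ht, h⟩ := exists_iterate_gam_succ_eq_append k
    have := List.length_pos_iff.mpr ht
    rw [h, List.length_append]
    omega

lemma isPrefix_iterate_gam {k l : ℕ} (h : k ≤ l) :
    (applyM gam)^[k] [0] <+: (applyM gam)^[l] [0] := by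
  induction l, h using Nat.le_induction with
  | base => exact List.prefix_rfl
  | succ l _ ih =>
    obtain ⟨t, -, h⟩ := exists_iterate_gam_succ_eq_append l
    exact ih.trans ⟨t, h.symm⟩

lemma isPrefix_map_G_range (n : ℕ) :
    (List.range n).map G <+: (applyM gam)^[n] [0] := by
  rw [List.prefix_iff_eq_take]
  have hn := lt_length_iterate_gam n
  apply List.ext_getElem
  · simp; omega
  · intro i h₁ h₂
    have hi : i < n := by simpa using h₁
    have hlen := lt_length_iterate_gam (i + 1)
    obtain ⟨t, ht⟩ := isPrefix_iterate_gam (show i + 1 ≤ n from hi)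
    simp only [List.getElem_map, List.getElem_range, List.getElem_take, G, ← ht]
    rw [List.getD_eq_getElem _ _ (by omega), List.getElem_append_left (by omega)]

/-- A prefix of `γ(x)` is the image of a prefix of `x`, up to a trailing `0`. -/
lemma prefix_applyM_gam {w x : Word} (h : w <+: applyM gam x) :
    ∃ y, y <+: x ∧ (w = applyM gam y ∨ w = applyM gam y ++ [0]) := by
  induction x generalizing w with
  | nil => exact ⟨[], List.prefix_rfl, Or.inl (by simpa [applyM] using h)⟩
  | cons a x ih =>
    have key : w = [] ∨ w = [0] ∨ ∃ v, v <+: applyM gam x ∧ w = gam a ++ v := by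
      rw [applyM_cons] at h
      fin_cases a <;> rcases w with _ | ⟨b, _ | ⟨c, w⟩⟩ <;>
        simp_all [gam, List.cons_prefix_cons]
    rcases key with rfl | rfl | ⟨v, hv, rfl⟩
    · exact ⟨[], List.nil_prefix, Or.inl rfl⟩
    · exact ⟨[], List.nil_prefix, Or.inr rfl⟩
    · obtain ⟨y, hy, hvy⟩ := ih hv
      refine ⟨a :: y, (List.prefix_cons_inj a).mpr hy, ?_⟩
      rcases hvy with rfl | rfl <;> simp [applyM_cons]

lemma count_zero_applyM_gam (u : Word) :
    (applyM gam u).count 0 = u.count 0 + u.count 2 := by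
  induction u with
  | nil => rfl
  | cons a u ih =>
    rw [applyM_cons, List.count_append, ih]
    fin_cases a <;> simp [gam] <;> omega

lemma count_one_applyM_gam (u : Word) : (applyM gam u).count 1 = u.count 0 := by
  induction u with
  | nil => rfl
  | cons a u ih =>
    rw [applyM_cons, List.count_append, ih]
    fin_cases a <;> simp [gam, Nat.add_comm]

lemma count_two_applyM_gam (u : Word) :
    (applyM gam u).count 2 = u.count 1 + u.count 2 := by
  induction u with
  | nil => rfl
  | cons a u ih =>
    rw [applyM_cons, List.count_append, ih]
    fin_cases a <;> simp [gam] <;> omega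

lemma length_eq_sum_count (u : Word) :
    u.length = u.count 0 + u.count 1 + u.count 2 := by
  induction u with
  | nil => rfl
  | cons a u ih => fin_cases a <;> simp [ih] <;> omega

/-- The dominant eigenvalue of the incidence matrix of `γ`. -/
lemma exists_dominant_root :
    ∃ β : ℝ, 1.75 ≤ β ∧ β ≤ 1.76 ∧ β ^ 3 - 2 * β ^ 2 + β - 1 = 0 := by
  have hc : ContinuousOn (fun x : ℝ => x ^ 3 - 2 * x ^ 2 + x - 1) (Set.Icc 1.75 1.76) := by
    fun_prop
  obtain ⟨β, hβ, h⟩ := intermediate_value_Icc (by norm_num) hc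
    (show (0 : ℝ) ∈ _ by constructor <;> norm_num)
  exact ⟨β, hβ.1, hβ.2, h⟩

/-- First coordinate of the deviation of the letter counts from the Perron direction
`(β, 1, β(β - 1))`. -/
def devZero (β : ℝ) (u : Word) : ℝ := u.count 0 - β * u.count 1

/-- Second coordinate of the deviation of the letter counts from the Perron direction. -/
def devTwo (β : ℝ) (u : Word) : ℝ := u.count 2 - β * (β - 1) * u.count 1

/-- The quadratic form on deviations which `γ` scales by `1 / β`. -/
def devForm (β p q : ℝ) : ℝ := β * (β - 1) * p ^ 2 - β * p * q + q ^ 2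

lemma devZero_append (β : ℝ) (u v : Word) :
    devZero β (u ++ v) = devZero β u + devZero β v := by
  simp only [devZero, List.count_append]; push_cast; ring

lemma devTwo_append (β : ℝ) (u v : Word) :
    devTwo β (u ++ v) = devTwo β u + devTwo β v := by
  simp only [devTwo, List.count_append]; push_cast; ring

lemma devZero_applyM_gam (β : ℝ) (u : Word) :
    devZero β (applyM gam u) = devTwo β u - (β - 1) * devZero β u := by
  simp only [devZero, devTwo, count_zero_applyM_gam, count_one_applyM_gam]
  push_cast; ring

lemma devTwo_applyM_gam {β : ℝ} (hβ : β ^ 3 - 2 * β ^ 2 + β - 1 = 0) (u : Word) :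
    devTwo β (applyM gam u) = devTwo β u - β * (β - 1) * devZero β u := by
  simp only [devZero, devTwo, count_one_applyM_gam, count_two_applyM_gam]
  push_cast
  linear_combination -(u.count 1 : ℝ) * hβ

lemma devForm_contract {β : ℝ} (hβ : β ^ 3 - 2 * β ^ 2 + β - 1 = 0) (p q : ℝ) :
    β * devForm β (q - (β - 1) * p) (q - β * (β - 1) * p) = devForm β p q := by
  have h : devForm β (q - (β - 1) * p) (q - β * (β - 1) * p)
      = (β - 1) ^ 2 * devForm β p q := by
    simp only [devForm]; ring
  rw [h]
  linear_combination devForm β p q * hβ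

lemma devForm_nonneg {β : ℝ} (h₁ : 1.75 ≤ β) (p q : ℝ) : 0 ≤ devForm β p q := by
  have h : devForm β p q = (q - β / 2 * p) ^ 2 + β * (3 / 4 * β - 1) * p ^ 2 := by
    simp only [devForm]; ring
  rw [h]
  have : 0 ≤ β * (3 / 4 * β - 1) := mul_nonneg (by linarith) (by linarith)
  positivity

lemma devForm_add_le {β : ℝ} (h₁ : 1.75 ≤ β) (p q p' q' : ℝ) :
    devForm β (p + p') (q + q') ≤ 3 / 2 * devForm β p q + 3 * devForm β p' q' := by
  have h := devForm_nonneg h₁ (p - 2 * p') (q - 2 * q')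
  simp only [devForm] at h ⊢
  linarith

lemma devForm_prefix_le {β : ℝ} (h₁ : 1.75 ≤ β) (h₂ : β ≤ 1.76)
    (hβ : β ^ 3 - 2 * β ^ 2 + β - 1 = 0) (k : ℕ) {w : Word}
    (hw : w <+: (applyM gam)^[k] [0]) : devForm β (devZero β w) (devTwo β w) ≤ 30 := by
  have hc : β * (β - 1) ≤ 1.3376 := by nlinarith
  induction k generalizing w with
  | zero =>
    rcases w with _ | ⟨a, _ | ⟨b, w⟩⟩
    · simp [devForm, devZero, devTwo]
    · obtain rfl : a = 0 := by simpa using hw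
      simp [devForm, devZero, devTwo]
      linarith
    · simp at hw
  | succ k ih =>
    rw [Function.iterate_succ_apply'] at hw
    obtain ⟨y, hy, hwy⟩ := prefix_applyM_gam hw
    have hQ := ih hy
    have himage : devForm β (devZero β (applyM gam y)) (devTwo β (applyM gam y)) ≤ 17.15 := by
      have h := devForm_contract hβ (devZero β y) (devTwo β y)
      have h0 := devForm_nonneg h₁ (devZero β (applyM gam y)) (devTwo β (applyM gam y))
      rw [devZero_applyM_gam, devTwo_applyM_gam hβ] at h0 ⊢
      nlinarith
    rcases hwy with rfl | rfl
    · linarith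
    · rw [devZero_append, devTwo_append]
      have h := devForm_add_le h₁ (devZero β (applyM gam y)) (devTwo β (applyM gam y))
        (devZero β [0]) (devTwo β [0])
      have h0 : devForm β (devZero β [0]) (devTwo β [0]) ≤ 1.3376 := by
        simpa [devForm, devZero, devTwo] using hc
      linarith

lemma abs_le_ten_of_devForm_le {β p q : ℝ} (h₁ : 1.75 ≤ β)
    (h : devForm β p q ≤ 30) : |p| ≤ 10 ∧ |q| ≤ 10 := by
  simp only [devForm] at h
  constructor <;> refine abs_le_of_sq_le_sq ?_ (by norm_num)
  · have hd : 0.5 ≤ β * (3 / 4 * β - 1) := by nlinarith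
    nlinarith [sq_nonneg (q - β / 2 * p), mul_le_mul_of_nonneg_right hd (sq_nonneg p)]
  · have hd : (0 : ℝ) ≤ β * (β - 1) - 5 / 12 * β ^ 2 := by
      have h := mul_nonneg (show (0 : ℝ) ≤ β by linarith)
        (show (0 : ℝ) ≤ 7 / 12 * β - 1 by linarith)
      linarith
    nlinarith [sq_nonneg (0.6 * q - β / 2 * p), mul_nonneg hd (sq_nonneg p)]

/-- Factors of `G` have bounded deviation from the Perron direction. -/
lemma abs_dev_le_of_isFactor {β : ℝ} (h₁ : 1.75 ≤ β) (h₂ : β ≤ 1.76)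
    (hβ : β ^ 3 - 2 * β ^ 2 + β - 1 = 0) {u : Word} (hu : IsFactor u G) :
    |devZero β u| ≤ 20 ∧ |devTwo β u| ≤ 20 := by
  obtain ⟨i, hi⟩ := hu
  have hsplit : (List.range (i + u.length)).map G = (List.range i).map G ++ u := by
    conv_rhs => rw [hi]
    rw [List.range_add]
    simp [Function.comp_def]
  have hbound (n : ℕ) := abs_le_ten_of_devForm_le h₁
    (devForm_prefix_le h₁ h₂ hβ n (isPrefix_map_G_range n))
  obtain ⟨hp, hq⟩ := hbound i
  obtain ⟨hp', hq'⟩ := hbound (i + u.length)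
  rw [hsplit, devZero_append] at hp'
  rw [hsplit, devTwo_append] at hq'
  simp only [abs_le] at hp hq hp' hq' ⊢
  refine ⟨⟨?_, ?_⟩, ?_, ?_⟩ <;> linarith

/-- The letter frequencies of `G`: the normalized Perron eigenvector. -/
noncomputable def freq (β : ℝ) : Sigma3 → ℝ :=
  ![β / (1 + β ^ 2), 1 / (1 + β ^ 2), β * (β - 1) / (1 + β ^ 2)]

lemma abs_count_sub_freq_mul_length_le {β : ℝ} (h₁ : 1.75 ≤ β) (h₂ : β ≤ 1.76)
    (hβ : β ^ 3 - 2 * β ^ 2 + β - 1 = 0) {u : Word} (hu : IsFactor u G) (a : Sigma3) :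
    |(u.count a : ℝ) - freq β a * u.length| ≤ 100 := by
  obtain ⟨hp, hq⟩ := abs_dev_le_of_isFactor h₁ h₂ hβ hu
  have hlen : (u.length : ℝ) = u.count 0 + u.count 1 + u.count 2 := by
    exact_mod_cast length_eq_sum_count u
  have hS : (0 : ℝ) < 1 + β ^ 2 := by positivity
  set p := devZero β u with hpdef
  set q := devTwo β u with hqdef
  have h0 : (u.count 0 : ℝ) = β * u.count 1 + p := by rw [hpdef, devZero]; ring
  have h2 : (u.count 2 : ℝ) = β * (β - 1) * u.count 1 + q := by rw [hqdef, devTwo]; ring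
  obtain ⟨r, hr⟩ : ∃ r, r = (p + q) / (1 + β ^ 2) := ⟨_, rfl⟩
  have hr' : |r| ≤ 40 := by
    rw [hr, abs_div, abs_of_pos hS, div_le_iff₀ hS]
    have := abs_add_le p q
    nlinarith
  have e0 : (u.count 0 : ℝ) - freq β 0 * u.length = p - β * r := by
    rw [hlen, h0, h2, hr]; simp [freq]; field_simp; ring
  have e1 : (u.count 1 : ℝ) - freq β 1 * u.length = - r := by
    rw [hlen, h0, h2, hr]; simp [freq]; field_simp; ring
  have e2 : (u.count 2 : ℝ) - freq β 2 * u.length = q - β * (β - 1) * r := by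
    rw [hlen, h0, h2, hr]; simp [freq]; field_simp; ring
  have hc : β * (β - 1) ≤ 2 := by nlinarith
  have hc0 : 0 ≤ β * (β - 1) := by nlinarith
  have hmul {c : ℝ} (hc0 : 0 ≤ c) (hc : c ≤ 2) : |c * r| ≤ 80 := by
    rw [abs_mul, abs_of_nonneg hc0]
    nlinarith [abs_nonneg r]
  fin_cases a
  · change |(u.count 0 : ℝ) - freq β 0 * u.length| ≤ 100
    rw [e0]
    linarith [abs_sub p (β * r), hmul (c := β) (by linarith) (by linarith)]
  · change |(u.count 1 : ℝ) - freq β 1 * u.length| ≤ 100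
    rw [e1, abs_neg]
    linarith
  · change |(u.count 2 : ℝ) - freq β 2 * u.length| ≤ 100
    rw [e2]
    linarith [abs_sub q (β * (β - 1) * r), hmul hc0 hc]

/-- `G` has uniform letter frequencies `ρ₀, ρ₁, ρ₂` summing to 1: for every `ε₁ > 0`
there is `N₁` such that every factor `u` of `G` of length at least `N₁` satisfies
`ρ_a - ε₁ < |u|_a/|u| < ρ_a + ε₁` for each letter `a`. -/
theorem stmt9 :
    ∃ ρ : Sigma3 → ℝ, (∀ a : Sigma3, 0 < ρ a) ∧ (ρ 0 + ρ 1 + ρ 2 = 1) ∧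
      ∀ ε : ℝ, 0 < ε → ∃ N : ℕ, ∀ u : Word, IsFactor u G → N ≤ u.length →
        ∀ a : Sigma3,
          ρ a - ε < (u.count a : ℝ) / (u.length : ℝ) ∧
          (u.count a : ℝ) / (u.length : ℝ) < ρ a + ε := by
  obtain ⟨β, h₁, h₂, hβ⟩ := exists_dominant_root
  have hS : (0 : ℝ) < 1 + β ^ 2 := by positivity
  refine ⟨freq β, fun a => ?_, ?_, fun ε hε => ?_⟩
  · have hβ0 : 0 < β := by linarith
    have hβ1 : 0 < β - 1 := by linarith
    fin_cases a <;> simp [freq] <;> positivity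
  · simp [freq]
    field_simp
    ring
  · obtain ⟨N, hN⟩ := exists_nat_gt (100 / ε)
    refine ⟨N, fun u hu hlen a => ?_⟩
    have hl : 100 / ε < (u.length : ℝ) := hN.trans_le (by exact_mod_cast hlen)
    have hpos : (0 : ℝ) < u.length := lt_trans (by positivity) hl
    rw [div_lt_iff₀ hε] at hl
    have h := abs_le.mp (abs_count_sub_freq_mul_length_le h₁ h₂ hβ hu a)
    rw [lt_div_iff₀ hpos, div_lt_iff₀ hpos]
    constructor <;> linarith
end

section
/- Let w : ℕ → Σ₃ be an infinite word that contains no factor of exponent 5/2 or greater and whose factor complexity equals 2n+1 for every n ≥ 0. Then there exists a permutation σ of Σ₃ such that the set of length-2 factors of σ(w) is one of the following seven sets: S₁={00,01,02,10,20}, S₂={01,02,10,11,20}, S₃={01,02,10,12,20}, S₄={00,01,11,12,20}, S₅={00,01,10,12,20}, S₆={00,01,12,20,21}, S₇={00,01,02,12,20}. -/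
/-- The length-`L` factor of `w` starting at position `i`. -/
def window {α : Type*} (w : ℕ → α) (i L : ℕ) : List α := (List.range L).map (fun j => w (i + j))

section Window

variable {α β : Type*} (w : ℕ → α)

@[simp] lemma length_window (i L : ℕ) : (window w i L).length = L := by
  simp [window]

lemma window_succ (i L : ℕ) : window w i (L + 1) = w i :: window w (i + 1) L := by
  simp only [window, List.range_succ_eq_map, List.map_cons, List.map_map, Nat.add_zero]
  congr 1
  refine List.map_congr_left fun j _ => ?_
  simp [Nat.add_comm, Nat.add_left_comm]

lemma map_window (f : α → β) (i L : ℕ) :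
    (window w i L).map f = window (fun n => f (w n)) i L := by
  simp [window]

lemma window_congr {w w' : ℕ → α} {i : ℕ} (h : ∀ n, i ≤ n → w n = w' n) (L : ℕ) :
    window w i L = window w' i L :=
  List.map_congr_left fun j _ => h _ (Nat.le_add_right i j)

end Window

lemma isFactor_window (w : InfWord) (i L : ℕ) : IsFactor (window w i L) w :=
  ⟨i, by simp [window]⟩

lemma isFactor_iff_exists_window {u : Word} {w : InfWord} :
    IsFactor u w ↔ ∃ i, u = window w i u.length := Iff.rfl

lemma getD_window (w : InfWord) (i : ℕ) {L j : ℕ} (h : j < L) :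
    (window w i L).getD j 0 = w (i + j) := by
  simp [window, h]

/-- A word without factors of exponent at least `5/2` has no window of length `m ≥ 5p/2`
with period `p`. -/
lemma NoFiveHalves.not_hasPeriod {w : InfWord} (hw : NoFiveHalves w) {i p m : ℕ}
    (hm : 5 * p ≤ 2 * m) : ¬ HasPeriod (window w i m) p := by
  intro h
  have hp : 1 ≤ p := h.1
  have hne : window w i m ≠ [] := by
    rw [← List.length_pos_iff, length_window]
    omega
  have hlt := hw _ hne (isFactor_window w i m)
  have hmem : HasPeriod (window w i m) (minPeriod (window w i m)) :=
    Nat.sInf_mem (s := {q | HasPeriod (window w i m) q}) ⟨p, h⟩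
  have hle : minPeriod (window w i m) ≤ p := Nat.sInf_le h
  have hpos : (0 : ℝ) < minPeriod (window w i m) := by exact_mod_cast hmem.1
  rw [expo, length_window, div_lt_iff₀ hpos] at hlt
  have h1 : (minPeriod (window w i m) : ℝ) ≤ p := by exact_mod_cast hle
  have h2 : (5 * p : ℝ) ≤ 2 * m := by exact_mod_cast hm
  linarith

/-- Some prefix of `u` of length `⌈5p/2⌉` has period `p`, for one of the listed values of `p`. -/
def startsWithPower (u : List Bool) : Bool :=
  [1, 2, 3, 4, 6, 7, 8, 10, 13].any fun p =>
    (u.take ((5 * p + 1) / 2 - p)).isPrefixOf (u.drop p) && decide ((5 * p + 1) / 2 ≤ u.length)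

lemma NoFiveHalves.startsWithPower_window {w : InfWord} (hw : NoFiveHalves w) {b : ℕ → Bool}
    {f : Bool → Sigma3} {i : ℕ} (hb : ∀ n, i ≤ n → w n = f (b n)) (L : ℕ) :
    startsWithPower (window b i L) = false := by
  by_contra h
  simp only [startsWithPower, Bool.not_eq_false, List.any_eq_true, Bool.and_eq_true,
    decide_eq_true_eq, length_window, List.isPrefixOf_iff_prefix] at h
  obtain ⟨p, hp, hpre, hL⟩ := h
  have hp1 : 1 ≤ p := by
    clear hpre hL
    revert p
    decide
  obtain ⟨m, hm⟩ : ∃ m, m = (5 * p + 1) / 2 := ⟨_, rfl⟩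
  rw [← hm] at hL hpre
  refine hw.not_hasPeriod (i := i) (p := p) (m := m) (by omega) ⟨hp1, fun j hj => ?_⟩
  rw [length_window] at hj
  rw [getD_window w i (by omega), getD_window w i hj, hb _ (by omega), hb _ (by omega)]
  have hlen : j < ((window b i L).take (m - p)).length := by
    simp only [List.length_take, length_window]
    omega
  have := hpre.getElem hlen
  simp only [List.getElem_take, List.getElem_drop, window, List.getElem_map,
    List.getElem_range] at this
  rw [this]
  congr 3
  omega

/-- Depth-bounded search showing that the binary word `x₀x₁x₂u` has no left extension by `n`
letters that avoids powers of exponent at least `5/2` and has at most eight factors of length four;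
`s` collects the factors of length four met so far. -/
def noLeftExtension : ℕ → Bool → Bool → Bool → List Bool → List (List Bool) → Bool
  | 0, _, _, _, _, _ => false
  | n + 1, x₀, x₁, x₂, u, s =>
    startsWithPower (x₀ :: x₁ :: x₂ :: u) || decide (8 < s.length) ||
      [true, false].all fun x =>
        if [x, x₀, x₁, x₂] ∈ s then noLeftExtension n x x₀ x₁ (x₂ :: u) s
        else noLeftExtension n x x₀ x₁ (x₂ :: u) ([x, x₀, x₁, x₂] :: s)

lemma noLeftExtension_true :
    ([true, false].all fun x => [true, false].all fun y =>
      noLeftExtension 40 x y true [] []) = true := by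
  decide +kernel

/-- The search is sound: windows of a word satisfying the constraints always extend. -/
lemma noLeftExtension_window {b : ℕ → Bool} {K : ℕ}
    (hpow : ∀ i, K ≤ i → ∀ L, startsWithPower (window b i L) = false)
    (hs : ∀ s : List (List Bool), s.Nodup → (∀ v ∈ s, ∃ i, K ≤ i ∧ v = window b i 4) →
      s.length ≤ 8) (n : ℕ) :
    ∀ (i L : ℕ) (s : List (List Bool)), K + n ≤ i → s.Nodup →
      (∀ v ∈ s, ∃ i, K ≤ i ∧ v = window b i 4) →
      noLeftExtension n (b i) (b (i + 1)) (b (i + 2)) (window b (i + 3) L) s = false := by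
  induction n with
  | zero => intros; rfl
  | succ n ih =>
    intro i L s hi hnd hmem
    obtain ⟨i, rfl⟩ : ∃ k, i = k + 1 := ⟨i - 1, by omega⟩
    have h8 : ¬ 8 < s.length := by simpa using hs s hnd hmem
    have hp := hpow (i + 1) (by omega) (L + 3)
    simp only [window_succ] at hp
    simp only [noLeftExtension, hp, h8, decide_false, Bool.or_false, Bool.false_or,
      List.all_eq_false]
    refine ⟨b i, by cases b i <;> simp, ?_⟩
    rw [Bool.not_eq_true, ← window_succ]
    split_ifs with hv
    · exact ih i (L + 1) s (by omega) hnd hmem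
    · refine ih i (L + 1) _ (by omega) (List.nodup_cons.2 ⟨hv, hnd⟩) fun v hv' => ?_
      rcases List.mem_cons.1 hv' with rfl | hv'
      · exact ⟨i, by omega, rfl⟩
      · exact hmem v hv'

lemma finite_isFactor_length (w : InfWord) (n : ℕ) :
    {u : Word | IsFactor u w ∧ u.length = n}.Finite :=
  (List.finite_length_eq Sigma3 n).subset fun _ h => h.2

/-- If `w` has three factors of length one, then every letter occurs in `w`. -/
lemma exists_eq_of_complexity_one {w : InfWord} (h : complexity w 1 = 3) (c : Sigma3) :
    ∃ k, w k = c := by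
  by_contra! hc
  have hsub : {u : Word | IsFactor u w ∧ u.length = 1} ⊆
      (fun x => [x]) '' (({c}ᶜ : Finset Sigma3) : Set Sigma3) := by
    rintro u ⟨hu, hlen⟩
    obtain ⟨i, hi⟩ := isFactor_iff_exists_window.1 hu
    rw [hlen] at hi
    exact ⟨w i, by simpa using hc i, by simp [hi, window]⟩
  have h1 := Set.ncard_le_ncard hsub ((Finset.finite_toSet _).image _)
  have h2 := Set.ncard_image_le (f := fun x : Sigma3 => [x])
    (Finset.finite_toSet ({c}ᶜ : Finset Sigma3))
  rw [Set.ncard_coe_finset, Finset.card_compl, Finset.card_singleton, Fintype.card_fin] at h2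
  rw [complexity] at h
  omega

lemma exists_third_letter : ∀ c d : Sigma3, d ≠ c →
    ∃ e, e ≠ c ∧ e ≠ d ∧ ∀ x, x ≠ c → x = d ∨ x = e := by
  decide

/-- Under the hypotheses of the theorem every letter occurs infinitely often. -/
lemma exists_ge_eq {w : InfWord} (hw : NoFiveHalves w) (h1 : complexity w 1 = 3)
    (h4 : complexity w 4 = 9) (c : Sigma3) (K : ℕ) : ∃ n, K ≤ n ∧ w n = c := by
  by_contra! hK
  obtain ⟨k, hk⟩ := exists_eq_of_complexity_one h1 c
  obtain ⟨e, hec, hed, he⟩ := exists_third_letter c (w (K + 42)) (hK _ (by omega))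
  obtain ⟨d, hd⟩ : ∃ d, w (K + 42) = d := ⟨_, rfl⟩
  have hdc : d ≠ c := hd ▸ hK _ (by omega)
  rw [hd] at hed he
  let f : Bool → Sigma3 := fun x => if x then d else e
  let b : ℕ → Bool := fun n => decide (w n = d)
  have hf : Function.Injective f := by
    rintro (_ | _) (_ | _) h <;> simp_all [f, eq_comm]
  have hfc : ∀ x, f x ≠ c := by
    rintro (_ | _) <;> simpa [f]
  have hb : ∀ n, K ≤ n → w n = f (b n) := by
    intro n hn
    rcases he _ (hK n hn) with h | h <;> simp [f, b, h, hed]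
  have hs : ∀ s : List (List Bool), s.Nodup → (∀ v ∈ s, ∃ i, K ≤ i ∧ v = window b i 4) →
      s.length ≤ 8 := by
    intro s hnd hmem
    have hnot : window w k 4 ∉ s.map (List.map f) := by
      intro h
      obtain ⟨v, -, hv⟩ := List.mem_map.1 h
      have hcv : c ∈ v.map f := by
        rw [hv, window_succ, hk]
        exact List.mem_cons_self
      obtain ⟨x, -, hx⟩ := List.mem_map.1 hcv
      exact hfc x hx
    have hsub : (((window w k 4 :: s.map (List.map f)).toFinset : Finset Word) : Set Word) ⊆
        {u : Word | IsFactor u w ∧ u.length = 4} := by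
      intro v hv
      have hv : ∃ i, v = window w i 4 := by
        rcases List.mem_cons.1 (List.mem_toFinset.1 hv) with rfl | hv
        · exact ⟨k, rfl⟩
        · obtain ⟨u, hu, rfl⟩ := List.mem_map.1 hv
          obtain ⟨i, hi, rfl⟩ := hmem u hu
          exact ⟨i, by rw [map_window, window_congr fun n hn => hb n (hi.trans hn)]⟩
      obtain ⟨i, rfl⟩ := hv
      exact ⟨isFactor_window _ _ _, length_window _ _ _⟩
    have hcard := Set.ncard_le_ncard hsub (finite_isFactor_length w 4)
    rw [Set.ncard_coe_finset, List.toFinset_card_of_nodup (List.nodup_cons.2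
      ⟨hnot, hnd.map (List.map_injective_iff.2 hf)⟩), List.length_cons, List.length_map] at hcard
    rw [complexity] at h4
    omega
  have hfalse := noLeftExtension_window
    (fun i hi => hw.startsWithPower_window fun n hn => hb n (hi.trans hn)) hs 40 (K + 40) 0 []
    le_rfl List.nodup_nil (by simp)
  have htrue := noLeftExtension_true
  rw [List.all_eq_true] at htrue
  have htrue := htrue (b (K + 40)) (by cases b (K + 40) <;> simp)
  rw [List.all_eq_true] at htrue
  have htrue := htrue (b (K + 41)) (by cases b (K + 41) <;> simp)
  have hb42 : b (K + 42) = true := by simp [b, hd]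
  rw [show window b (K + 40 + 3) 0 = [] from rfl, hb42, htrue] at hfalse
  exact Bool.noConfusion hfalse

open Classical in
/-- The pairs of consecutive letters of `w`. -/
noncomputable def letterPairs (w : InfWord) : Finset (Sigma3 × Sigma3) :=
  Finset.univ.filter fun p => ∃ n, (w n, w (n + 1)) = p

lemma mem_letterPairs {w : InfWord} {p : Sigma3 × Sigma3} :
    p ∈ letterPairs w ↔ ∃ n, (w n, w (n + 1)) = p := by
  simp [letterPairs]

lemma setOf_isFactor_length_two (w : InfWord) :
    {u : Word | IsFactor u w ∧ u.length = 2} =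
      (fun p : Sigma3 × Sigma3 => [p.1, p.2]) '' (letterPairs w : Set (Sigma3 × Sigma3)) := by
  ext u
  constructor
  · rintro ⟨hu, hlen⟩
    obtain ⟨i, hi⟩ := isFactor_iff_exists_window.1 hu
    rw [hlen] at hi
    exact ⟨(w i, w (i + 1)), mem_letterPairs.2 ⟨i, rfl⟩, by rw [hi]; rfl⟩
  · rintro ⟨p, hp, rfl⟩
    obtain ⟨i, rfl⟩ := mem_letterPairs.1 hp
    exact ⟨isFactor_window w i 2, rfl⟩

lemma card_letterPairs (w : InfWord) : (letterPairs w).card = complexity w 2 := by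
  rw [complexity, setOf_isFactor_length_two, Set.ncard_image_of_injective, Set.ncard_coe_finset]
  rintro ⟨a, b⟩ ⟨c, d⟩ h
  simpa using h

lemma letterPairs_comp (w : InfWord) (σ : Equiv.Perm Sigma3) :
    letterPairs (fun n => σ (w n)) = (letterPairs w).image (Prod.map σ σ) := by
  ext p
  simp only [mem_letterPairs, Finset.mem_image]
  constructor
  · rintro ⟨n, rfl⟩
    exact ⟨_, ⟨n, rfl⟩, rfl⟩
  · rintro ⟨_, ⟨n, rfl⟩, rfl⟩
    exact ⟨n, rfl⟩

lemma exists_step_of_le {P : ℕ → Prop} {i j : ℕ} (hij : i ≤ j) (hi : P i) (hj : ¬ P j) :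
    ∃ n, P n ∧ ¬ P (n + 1) := by
  by_contra! h
  exact hj (Nat.le_induction hi (fun n _ => h n) j hij)

/-- Strongly connected directed graphs with five edges on three vertices, up to isomorphism. -/
lemma exists_perm_image_eq : ∀ E ∈ Finset.powersetCard 5 (Finset.univ : Finset (Sigma3 × Sigma3)),
    (∀ x, ∃ y, y ≠ x ∧ (x, y) ∈ E) → (∀ x, ∃ y, y ≠ x ∧ (y, x) ∈ E) →
    ∃ σ : Equiv.Perm Sigma3, E.image (Prod.map σ σ) ∈
      ([{(0, 0), (0, 1), (0, 2), (1, 0), (2, 0)}, {(0, 1), (0, 2), (1, 0), (1, 1), (2, 0)},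
        {(0, 1), (0, 2), (1, 0), (1, 2), (2, 0)}, {(0, 0), (0, 1), (1, 1), (1, 2), (2, 0)},
        {(0, 0), (0, 1), (1, 0), (1, 2), (2, 0)}, {(0, 0), (0, 1), (1, 2), (2, 0), (2, 1)},
        {(0, 0), (0, 1), (0, 2), (1, 2), (2, 0)}] : List (Finset (Sigma3 × Sigma3))) := by
  decide +kernel

/-- If `w` avoids exponents `≥ 5/2` and has factor complexity `2n+1`, then up to a
permutation `σ` of Σ₃ its set of length-2 factors is one of the seven sets
`S₁, …, S₇`. -/
theorem stmt11 (w : InfWord) (hp : NoFiveHalves w)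
    (hc : ∀ n : ℕ, complexity w n = 2 * n + 1) :
    ∃ σ : Equiv.Perm Sigma3,
      ({u : Word | IsFactor u (fun n => σ (w n)) ∧ u.length = 2} = ({[0, 0], [0, 1], [0, 2], [1, 0], [2, 0]} : Set Word) ∨
      {u : Word | IsFactor u (fun n => σ (w n)) ∧ u.length = 2} = ({[0, 1], [0, 2], [1, 0], [1, 1], [2, 0]} : Set Word) ∨
      {u : Word | IsFactor u (fun n => σ (w n)) ∧ u.length = 2} = ({[0, 1], [0, 2], [1, 0], [1, 2], [2, 0]} : Set Word) ∨
      {u : Word | IsFactor u (fun n => σ (w n)) ∧ u.length = 2} = ({[0, 0], [0, 1], [1, 1], [1, 2], [2, 0]} : Set Word) ∨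
      {u : Word | IsFactor u (fun n => σ (w n)) ∧ u.length = 2} = ({[0, 0], [0, 1], [1, 0], [1, 2], [2, 0]} : Set Word) ∨
      {u : Word | IsFactor u (fun n => σ (w n)) ∧ u.length = 2} = ({[0, 0], [0, 1], [1, 2], [2, 0], [2, 1]} : Set Word) ∨
      {u : Word | IsFactor u (fun n => σ (w n)) ∧ u.length = 2} = ({[0, 0], [0, 1], [0, 2], [1, 2], [2, 0]} : Set Word)) := by
  have hinf := exists_ge_eq hp (hc 1) (hc 4)
  have hne : ∀ x : Sigma3, ∃ y, y ≠ x := by decide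
  obtain ⟨σ, hσ⟩ := exists_perm_image_eq (letterPairs w)
    (by simp [Finset.mem_powersetCard, card_letterPairs, hc 2])
    (fun x => by
      obtain ⟨y, hy⟩ := hne x
      obtain ⟨i, -, hi⟩ := hinf x 0
      obtain ⟨j, hij, hj⟩ := hinf y i
      obtain ⟨n, rfl, hn⟩ := exists_step_of_le (P := fun n => w n = x) hij hi (by simpa [hj])
      exact ⟨_, hn, mem_letterPairs.2 ⟨n, rfl⟩⟩)
    (fun x => by
      obtain ⟨y, hy⟩ := hne x
      obtain ⟨i, -, hi⟩ := hinf y 0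
      obtain ⟨j, hij, hj⟩ := hinf x i
      obtain ⟨n, hn, hn'⟩ := exists_step_of_le (P := fun n => w n ≠ x) hij (by simpa [hi])
        (by simpa)
      exact ⟨_, hn, mem_letterPairs.2 ⟨n, by rw [not_not.1 hn']⟩⟩)
  refine ⟨σ, ?_⟩
  simp only [List.mem_cons, List.not_mem_nil, or_false] at hσ
  rw [setOf_isFactor_length_two, letterPairs_comp]
  rcases hσ with h | h | h | h | h | h | h <;> rw [h] <;>
    simp only [Finset.coe_insert, Finset.coe_singleton, Set.image_insert_eq, Set.image_singleton,
      true_or, or_true]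
end
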